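/- For every integer n ≥ 2, there exists a prime number p with n ≤ p < 2n such that p ≡ 3 (mod 8) or p ≡ 5 (mod 8). -/

import Mathlib

open Finset Chebyshev

/-- The character modulo `8` which is `-1` exactly on the classes `3` and `5`. -/
def chi (n : ℕ) : ℤ := ZMod.χ₈ n

/-- The principal character modulo `2`. -/
def chi₀ (n : ℕ) : ℤ := (n % 2 : ℕ)

/-- The sum of `chi` over `1, …, t`. -/
def chiSum (t : ℕ) : ℤ :=
  if t % 8 = 1 ∨ t % 8 = 2 then 1 else if t % 8 = 5 ∨ t % 8 = 6 then -1 else 0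

/-- The number of odd integers among `1, …, t`. -/
def oddCount (t : ℕ) : ℤ := ((t + 1) / 2 : ℕ)

theorem chi_eq (n : ℕ) :
    chi n = if n % 2 = 0 then 0 else if n % 8 = 1 ∨ n % 8 = 7 then 1 else -1 :=
  ZMod.χ₈_nat_eq_if_mod_eight n

theorem chi_mul (m n : ℕ) : chi (m * n) = chi m * chi n := by
  unfold chi
  rw [Nat.cast_mul, map_mul]

theorem chi₀_mul (m n : ℕ) : chi₀ (m * n) = chi₀ m * chi₀ n := by
  unfold chi₀
  rw [Nat.mul_mod]
  rcases Nat.mod_two_eq_zero_or_one m with h | h <;>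
    rcases Nat.mod_two_eq_zero_or_one n with h' | h' <;> simp [h, h']

theorem sum_chi (t : ℕ) : ∑ k ∈ Ioc 0 t, chi k = chiSum t := by
  induction t with
  | zero => simp [chiSum]
  | succ t ih =>
    rw [sum_Ioc_succ_top (Nat.zero_le t), ih, chi_eq]
    unfold chiSum
    split_ifs <;> omega

theorem sum_chi₀ (t : ℕ) : ∑ k ∈ Ioc 0 t, chi₀ k = oddCount t := by
  induction t with
  | zero => simp [oddCount]
  | succ t ih =>
    rw [sum_Ioc_succ_top (Nat.zero_le t), ih]
    unfold oddCount chi₀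
    omega

/-- The sum of `c m * log m` over `1 ≤ m ≤ N`. -/
noncomputable def logSum (c : ℕ → ℤ) (N : ℕ) : ℝ := ∑ m ∈ Ioc 0 N, (c m : ℝ) * Real.log m

theorem logSum_succ (c : ℕ → ℤ) (N : ℕ) :
    logSum c (N + 1) = logSum c N + c (N + 1) * Real.log ((N : ℝ) + 1) := by
  unfold logSum
  rw [sum_Ioc_succ_top (Nat.zero_le N)]
  push_cast
  rfl

theorem logSum_eq_sum_vonMangoldt {c : ℕ → ℤ} (h0 : c 0 = 0)
    (hmul : ∀ m n, c (m * n) = c m * c n) (N : ℕ) :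
    logSum c N = ∑ d ∈ Ioc 0 N, ArithmeticFunction.vonMangoldt d *
      (c d * (∑ k ∈ Ioc 0 (N / d), c k : ℤ)) := by
  let f : ArithmeticFunction ℝ :=
    ⟨fun n ↦ ArithmeticFunction.vonMangoldt n * c n, by simp⟩
  let g : ArithmeticFunction ℝ := ⟨fun n ↦ c n, by simp [h0]⟩
  have key : ∀ n, (f * g) n = c n * Real.log n := by
    intro n
    rw [ArithmeticFunction.mul_apply, ← ArithmeticFunction.vonMangoldt_sum,
      ← Nat.sum_divisorsAntidiagonal (f := fun d _ ↦ ArithmeticFunction.vonMangoldt d), mul_sum]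
    refine sum_congr rfl fun x hx ↦ ?_
    rw [← (Nat.mem_divisorsAntidiagonal.1 hx).1, hmul]
    simp only [f, g, ArithmeticFunction.coe_mk]
    push_cast
    ring
  unfold logSum
  simp_rw [← key]
  rw [ArithmeticFunction.sum_Ioc_mul_eq_sum_sum]
  refine sum_congr rfl fun d _ ↦ ?_
  simp only [f, g, ArithmeticFunction.coe_mk]
  push_cast
  ring

theorem logSum_div_eq_sum_vonMangoldt {c : ℕ → ℤ} (h0 : c 0 = 0)
    (hmul : ∀ m n, c (m * n) = c m * c n) (N j : ℕ) :
    logSum c (N / j) = ∑ d ∈ Ioc 0 N, ArithmeticFunction.vonMangoldt d *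
      (c d * (∑ k ∈ Ioc 0 (N / d / j), c k : ℤ)) := by
  rw [logSum_eq_sum_vonMangoldt h0 hmul]
  have hsub : Ioc 0 (N / j) ⊆ Ioc 0 N := Ioc_subset_Ioc_right (Nat.div_le_self N j)
  rw [← sum_subset hsub]
  · refine sum_congr rfl fun d _ ↦ ?_
    rw [Nat.div_div_eq_div_mul, Nat.div_div_eq_div_mul, mul_comm j d]
  · intro d hd hd'
    have : N / j / d = 0 := by
      rw [Nat.div_eq_zero_iff]
      simp only [mem_Ioc] at hd hd'
      omega
    rw [Nat.div_div_eq_div_mul, mul_comm d j, ← Nat.div_div_eq_div_mul, this]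
    simp

theorem logSum_chi_div (N j : ℕ) :
    logSum chi (N / j) = ∑ d ∈ Ioc 0 N, ArithmeticFunction.vonMangoldt d *
      (chi d * chiSum (N / d / j)) := by
  rw [logSum_div_eq_sum_vonMangoldt (by simp [chi]) chi_mul]
  simp_rw [sum_chi]

theorem logSum_chi₀_div (N j : ℕ) :
    logSum chi₀ (N / j) = ∑ d ∈ Ioc 0 N, ArithmeticFunction.vonMangoldt d *
      (chi₀ d * oddCount (N / d / j)) := by
  rw [logSum_div_eq_sum_vonMangoldt (by simp [chi₀]) chi₀_mul]
  simp_rw [sum_chi₀]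

/-- The combination of dilates of `oddCount` used to isolate the interval `(N / 2, N]`. -/
def oddComb (t : ℕ) : ℤ :=
  oddCount t - oddCount (t / 2) - oddCount (t / 3) - oddCount (t / 4) + oddCount (t / 12)

/-- The combination of dilates of `chiSum` used to separate the residue classes. -/
def chiComb (t : ℕ) : ℤ :=
  -chiSum t + chiSum (t / 2) - chiSum (t / 3) - chiSum (t / 4) + 2 * chiSum (t / 6)
    - chiSum (t / 12)

theorem oddComb_mod (t : ℕ) : oddComb (t % 96) = oddComb t := by
  have h (j k : ℕ) (hj : t / j = t % 96 / j + 2 * (k * (t / 96))) :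
      oddCount (t / j) = oddCount (t % 96 / j) + k * ((t / 96 : ℕ) : ℤ) := by
    rw [hj, oddCount, oddCount, ← Nat.cast_mul, ← Nat.cast_add]
    congr 1
    omega
  have h₁ := h 1 48 (by omega)
  rw [Nat.div_one, Nat.div_one] at h₁
  unfold oddComb
  rw [h₁, h 2 24 (by omega), h 3 16 (by omega), h 4 12 (by omega), h 12 4 (by omega)]
  ring

theorem chiSum_congr {s t : ℕ} (h : s % 8 = t % 8) : chiSum s = chiSum t := by
  simp [chiSum, h]

theorem chiComb_mod (t : ℕ) : chiComb (t % 96) = chiComb t := by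
  unfold chiComb
  rw [chiSum_congr (s := t % 96) (t := t) (by omega),
    chiSum_congr (s := t % 96 / 2) (t := t / 2) (by omega),
    chiSum_congr (s := t % 96 / 3) (t := t / 3) (by omega),
    chiSum_congr (s := t % 96 / 4) (t := t / 4) (by omega),
    chiSum_congr (s := t % 96 / 6) (t := t / 6) (by omega),
    chiSum_congr (s := t % 96 / 12) (t := t / 12) (by omega)]

theorem comb_bounds_of_lt : ∀ t < 96,
    oddComb t + chiComb t ≤ 2 * ((if 13 ≤ t then 1 else 0) + if 31 ≤ t then 1 else 0) ∧
    oddComb t - chiComb t ≤ 2 * ((if t ≤ 1 then 1 else 0) + (if 13 ≤ t then 1 else 0) +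
      if 31 ≤ t then 1 else 0) ∧
    oddComb t + chiComb t ≤ 4 ∧ oddComb t - chiComb t ≤ 4 := by
  decide

theorem comb_bounds (t : ℕ) :
    oddComb t + chiComb t ≤ 2 * ((if 13 ≤ t then 1 else 0) + if 31 ≤ t then 1 else 0) ∧
    oddComb t - chiComb t ≤ 2 * ((if t ≤ 1 then 1 else 0) + (if 13 ≤ t then 1 else 0) +
      if 31 ≤ t then 1 else 0) := by
  rcases lt_or_ge t 96 with ht | ht
  · exact ⟨(comb_bounds_of_lt t ht).1, (comb_bounds_of_lt t ht).2.1⟩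
  · have h := (comb_bounds_of_lt (t % 96) (Nat.mod_lt _ (by norm_num))).2.2
    rw [oddComb_mod, chiComb_mod] at h
    rw [if_pos (by omega), if_pos (by omega), if_neg (by omega)]
    omega

theorem character_comb_le (d t : ℕ) :
    chi₀ d * oddComb t + chi d * chiComb t ≤
      2 * ((if (d % 8 = 3 ∨ d % 8 = 5) ∧ t ≤ 1 then 1 else 0) + (if 13 ≤ t then 1 else 0) +
        if 31 ≤ t then 1 else 0) := by
  obtain ⟨h₁, h₂⟩ := comb_bounds t
  rw [chi_eq, chi₀]
  have h := Nat.mod_lt d (show 0 < 8 by norm_num)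
  rcases Nat.mod_two_eq_zero_or_one d with hd | hd
  · rw [if_pos hd, hd]
    split_ifs <;> simp
  · rw [if_neg (by omega), hd]
    by_cases h' : d % 8 = 1 ∨ d % 8 = 7
    · rw [if_pos h', if_neg (c := _ ∧ _) (by omega)]
      push_cast
      linarith
    · rw [if_neg h']
      have h35 : d % 8 = 3 ∨ d % 8 = 5 := by omega
      simp only [h35, true_and]
      push_cast
      linarith

theorem psi_nat_div (N j : ℕ) (hj : 0 < j) :
    ∑ d ∈ Ioc 0 N, ArithmeticFunction.vonMangoldt d * (if j ≤ N / d then 1 else 0) =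
      ψ (N / j) := by
  rw [psi, Nat.floor_div_natCast, Nat.floor_natCast]
  simp only [mul_ite, mul_one, mul_zero]
  rw [← sum_filter]
  refine sum_congr ?_ fun _ _ ↦ rfl
  ext d
  simp only [mem_filter, mem_Ioc]
  constructor
  · rintro ⟨⟨h, -⟩, h'⟩
    refine ⟨h, (Nat.le_div_iff_mul_le hj).2 ?_⟩
    rw [mul_comm]
    exact (Nat.le_div_iff_mul_le h).1 h'
  · rintro ⟨h, h'⟩
    refine ⟨⟨h, h'.trans (Nat.div_le_self N j)⟩, (Nat.le_div_iff_mul_le h).2 ?_⟩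
    rw [mul_comm]
    exact (Nat.le_div_iff_mul_le hj).1 h'

/-- The combination of the sums `logSum` corresponding to `oddComb` and `chiComb`. -/
noncomputable def logComb (N : ℕ) : ℝ :=
  (logSum chi₀ N - logSum chi₀ (N / 2) - logSum chi₀ (N / 3) - logSum chi₀ (N / 4) +
    logSum chi₀ (N / 12)) +
  (-logSum chi N + logSum chi (N / 2) - logSum chi (N / 3) - logSum chi (N / 4) +
    2 * logSum chi (N / 6) - logSum chi (N / 12))

theorem logComb_eq (N : ℕ) : logComb N = ∑ d ∈ Ioc 0 N, ArithmeticFunction.vonMangoldt d *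
    (chi₀ d * oddComb (N / d) + chi d * chiComb (N / d) : ℤ) := by
  unfold logComb
  have h₁ := logSum_chi_div N 1
  have h₂ := logSum_chi₀_div N 1
  simp only [Nat.div_one] at h₁ h₂
  simp only [h₁, h₂, logSum_chi_div, logSum_chi₀_div, mul_sum, ← sum_sub_distrib,
    ← sum_add_distrib, ← sum_neg_distrib]
  refine sum_congr rfl fun d _ ↦ ?_
  unfold oddComb chiComb
  push_cast
  ring

theorem logComb_le {N : ℕ}
    (hN : ∀ p, p.Prime → N < 2 * p → p ≤ N → ¬(p % 8 = 3 ∨ p % 8 = 5)) :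
    logComb N ≤ 2 * ((ψ N - θ N) + ψ (N / 13) + ψ (N / 31)) := by
  have h13 := psi_nat_div N 13 (by norm_num)
  have h31 := psi_nat_div N 31 (by norm_num)
  push_cast at h13 h31
  rw [logComb_eq, psi_sub_theta_eq_sum_not_prime, Nat.floor_natCast, ← h13, ← h31, sum_filter,
    ← sum_add_distrib, ← sum_add_distrib, mul_sum]
  refine sum_le_sum fun d hd ↦ ?_
  have hΛ : 0 ≤ ArithmeticFunction.vonMangoldt d := ArithmeticFunction.vonMangoldt_nonneg
  have h := character_comb_le d (N / d)
  have h' : (2 * ((if (d % 8 = 3 ∨ d % 8 = 5) ∧ N / d ≤ 1 then 1 else 0) +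
      (if 13 ≤ N / d then 1 else 0) + if 31 ≤ N / d then 1 else 0) : ℤ) ≤
      2 * ((if ¬d.Prime then 1 else 0) +
      (if 13 ≤ N / d then 1 else 0) + if 31 ≤ N / d then 1 else 0) := by
    gcongr
    by_cases hp : d.Prime
    · rw [if_neg]
      · simp [hp]
      · rintro ⟨hd', hle⟩
        rw [mem_Ioc] at hd
        exact hN d hp ((Nat.div_lt_iff_lt_mul hd.1).1 (by omega)) hd.2 hd'
    · simp only [hp, not_false_eq_true, if_true]
      split_ifs <;> simp
  have h'' := mul_le_mul_of_nonneg_left (Int.cast_le (R := ℝ).2 (h.trans h')) hΛ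
  refine h''.trans_eq ?_
  push_cast
  split_ifs <;> ring

theorem logSum_chi_eight_mul_add (k : ℕ) :
    logSum chi (8 * k + 1) = logSum chi (8 * k) + Real.log (8 * k + 1) ∧
    logSum chi (8 * k + 2) = logSum chi (8 * k + 1) ∧
    logSum chi (8 * k + 3) = logSum chi (8 * k + 1) - Real.log (8 * k + 3) ∧
    logSum chi (8 * k + 4) = logSum chi (8 * k + 3) ∧
    logSum chi (8 * k + 5) = logSum chi (8 * k + 3) - Real.log (8 * k + 5) ∧
    logSum chi (8 * k + 6) = logSum chi (8 * k + 5) ∧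
    logSum chi (8 * k + 7) = logSum chi (8 * k + 5) + Real.log (8 * k + 7) ∧
    logSum chi (8 * k + 8) = logSum chi (8 * k + 7) := by
  have step (r : ℕ) (c : ℤ) (hc : chi (8 * k + r + 1) = c) :
      logSum chi (8 * k + r + 1) =
        logSum chi (8 * k + r) + c * Real.log (8 * k + (r + 1 : ℕ)) := by
    rw [logSum_succ, hc]
    push_cast
    rw [add_assoc]
  have h₁ := step 0 1 (by rw [chi_eq, if_neg (by omega), if_pos (by omega)])
  have h₂ := step 1 0 (by rw [chi_eq, if_pos (by omega)])
  have h₃ := step 2 (-1) (by rw [chi_eq, if_neg (by omega), if_neg (by omega)])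
  have h₄ := step 3 0 (by rw [chi_eq, if_pos (by omega)])
  have h₅ := step 4 (-1) (by rw [chi_eq, if_neg (by omega), if_neg (by omega)])
  have h₆ := step 5 0 (by rw [chi_eq, if_pos (by omega)])
  have h₇ := step 6 1 (by rw [chi_eq, if_neg (by omega), if_pos (by omega)])
  have h₈ := step 7 0 (by rw [chi_eq, if_pos (by omega)])
  norm_num [add_assoc] at h₁ h₂ h₃ h₄ h₅ h₆ h₇ h₈
  refine ⟨h₁, h₂, ?_, h₄, ?_, h₆, ?_, h₈⟩ <;> linarith

theorem log_add_log_le_log_add_log {a b c d : ℝ} (ha : 0 < a) (hb : 0 < b) (hc : 0 < c)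
    (hd : 0 < d) (h : a * b ≤ c * d) : Real.log a + Real.log b ≤ Real.log c + Real.log d := by
  rw [← Real.log_mul ha.ne' hb.ne', ← Real.log_mul hc.ne' hd.ne']
  exact Real.log_le_log (by positivity) h

theorem log_eight_mul_add_one_add_log_le (k : ℕ) :
    Real.log (8 * k + 1) + Real.log (8 * k + 7) ≤ Real.log (8 * k + 3) + Real.log (8 * k + 5) :=
  log_add_log_le_log_add_log (by positivity) (by positivity) (by positivity) (by positivity)
    (by nlinarith)

theorem logSum_chi_eight_mul (k : ℕ) :
    0 ≤ logSum chi (8 * k + 1) ∧ logSum chi (8 * k) ≤ 0 := by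
  induction k with
  | zero => simp [logSum]
  | succ k ih =>
    have h := logSum_chi_eight_mul_add k
    have h' := (logSum_chi_eight_mul_add (k + 1)).1
    have h₁ := log_eight_mul_add_one_add_log_le k
    have h₂ : Real.log (8 * k + 3) + Real.log (8 * k + 5) ≤
        Real.log (8 * k + 7) + Real.log (8 * (k + 1 : ℕ) + 1) :=
      log_add_log_le_log_add_log (by positivity) (by positivity) (by positivity) (by positivity)
        (by push_cast; nlinarith)
    rw [show 8 * (k + 1) = 8 * k + 8 by ring] at h' ⊢
    constructor <;> linarith

theorem logSum_chi_bounds {N : ℕ} (hN : 1 ≤ N) :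
    -(2 * Real.log N) ≤ logSum chi N ∧ logSum chi N ≤ Real.log N := by
  obtain ⟨k, r, hr, rfl⟩ : ∃ k r, r < 8 ∧ N = 8 * k + (r + 1) :=
    ⟨(N - 1) / 8, (N - 1) % 8, Nat.mod_lt _ (by norm_num), by omega⟩
  have h := logSum_chi_eight_mul_add k
  have h₀ := logSum_chi_eight_mul k
  have hlog := log_eight_mul_add_one_add_log_le k
  have hmono (i : ℕ) (hi : 1 ≤ i) (hir : i ≤ r + 1) :
      Real.log (8 * k + i) ≤ Real.log (8 * k + (r + 1 : ℕ)) := by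
    refine Real.log_le_log (by positivity) ?_
    gcongr
  have hnonneg : 0 ≤ Real.log (8 * k + 7) := Real.log_nonneg (by linarith [k.cast_nonneg (α := ℝ)])
  have hnonneg₃ : 0 ≤ Real.log (8 * k + 3) := Real.log_nonneg (by linarith [k.cast_nonneg (α := ℝ)])
  have hnonneg₅ : 0 ≤ Real.log (8 * k + 5) := Real.log_nonneg (by linarith [k.cast_nonneg (α := ℝ)])
  have h1 := hmono 1 le_rfl (by omega)
  have hpos : 0 ≤ Real.log (8 * k + (r + 1 : ℕ)) :=
    Real.log_nonneg (by push_cast; linarith [k.cast_nonneg (α := ℝ), r.cast_nonneg (α := ℝ)])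
  have h3 := hmono 3 (by norm_num)
  have h5 := hmono 5 (by norm_num)
  push_cast at h1 h3 h5 hpos ⊢
  interval_cases r <;> norm_num at h1 h3 h5 hpos ⊢ <;> constructor <;> linarith

/-- The main term of the sum of `log m` over odd `m ≤ x`. -/
noncomputable def halfEntropy (x : ℝ) : ℝ := x / 2 * (Real.log x - 1)

theorem sub_mul_log_le_halfEntropy {x y : ℝ} (hx : 0 < x) (hy : 0 < y) :
    (y - x) / 2 * Real.log x ≤ halfEntropy y - halfEntropy x := by
  have h := Real.one_sub_inv_le_log_of_pos (div_pos hy hx)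
  rw [Real.log_div hy.ne' hx.ne', inv_div] at h
  have h' := mul_le_mul_of_nonneg_left h hy.le
  rw [mul_sub, mul_one, mul_div_cancel₀ _ hy.ne'] at h'
  unfold halfEntropy
  linarith

theorem halfEntropy_sub_le {x y : ℝ} (hx : 0 < x) (hy : 0 < y) :
    halfEntropy y - halfEntropy x ≤ (y - x) / 2 * Real.log y := by
  linarith [sub_mul_log_le_halfEntropy hy hx]

theorem logSum_chi₀_odd (k : ℕ) :
    halfEntropy (2 * k + 1) + 1 / 2 ≤ logSum chi₀ (2 * k + 1) ∧
      logSum chi₀ (2 * k + 1) ≤ halfEntropy (2 * k + 3) + 1 / 2 := by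
  induction k with
  | zero =>
    have h := sub_mul_log_le_halfEntropy (x := 1) (y := 3) (by norm_num) (by norm_num)
    have h₁ : halfEntropy 1 = -(1 / 2) := by norm_num [halfEntropy]
    simp only [Real.log_one, mul_zero, h₁] at h
    have h₀ : logSum chi₀ 1 = 0 := by simp [logSum]
    simp only [CharP.cast_eq_zero, mul_zero, zero_add, h₀, h₁]
    constructor <;> linarith
  | succ k ih =>
    have hs : logSum chi₀ (2 * (k + 1) + 1) =
        logSum chi₀ (2 * k + 1) + Real.log (2 * k + 3) := by
      rw [show 2 * (k + 1) + 1 = 2 * k + 1 + 1 + 1 by ring, logSum_succ, logSum_succ,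
        show chi₀ (2 * k + 1 + 1) = 0 by unfold chi₀; omega,
        show chi₀ (2 * k + 1 + 1 + 1) = 1 by unfold chi₀; omega]
      push_cast
      ring_nf
    have h₁ := halfEntropy_sub_le (x := 2 * k + 1) (y := 2 * k + 3) (by positivity) (by positivity)
    have h₂ := sub_mul_log_le_halfEntropy (x := 2 * k + 3) (y := 2 * k + 5) (by positivity)
      (by positivity)
    rw [hs]
    push_cast
    rw [show (2 * ((k : ℝ) + 1) + 1) = 2 * k + 3 by ring,
      show (2 * ((k : ℝ) + 1) + 3) = 2 * k + 5 by ring]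
    constructor <;> linarith

theorem logSum_chi₀_bounds {x : ℝ} (hx : 1 ≤ x) :
    halfEntropy x - Real.log x ≤ logSum chi₀ ⌊x⌋₊ ∧
      logSum chi₀ ⌊x⌋₊ ≤ halfEntropy x + Real.log (x + 2) + 1 / 2 := by
  have hm : 1 ≤ ⌊x⌋₊ := (Nat.one_le_floor_iff x).2 hx
  obtain ⟨k, hk⟩ : ∃ k, ⌊x⌋₊ = 2 * k + 1 ∨ ⌊x⌋₊ = 2 * k + 2 :=
    ⟨(⌊x⌋₊ - 1) / 2, by omega⟩
  have heq : logSum chi₀ ⌊x⌋₊ = logSum chi₀ (2 * k + 1) := by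
    rcases hk with hk | hk
    · rw [hk]
    · rw [hk, logSum_succ, show chi₀ (2 * k + 1 + 1) = 0 by unfold chi₀; omega]
      simp
  have hlow : (2 * k + 1 : ℝ) ≤ x := by
    refine le_trans ?_ (Nat.floor_le (by linarith : 0 ≤ x))
    exact_mod_cast (by omega : 2 * k + 1 ≤ ⌊x⌋₊)
  have hup : x ≤ 2 * k + 3 := by
    refine (Nat.lt_floor_add_one x).le.trans ?_
    exact_mod_cast (by omega : ⌊x⌋₊ + 1 ≤ 2 * k + 3)
  have hlogx : 0 ≤ Real.log x := Real.log_nonneg hx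
  obtain ⟨h₁, h₂⟩ := logSum_chi₀_odd k
  have h₃ := sub_mul_log_le_halfEntropy (x := x) (y := 2 * k + 1) (by linarith) (by positivity)
  have h₄ := halfEntropy_sub_le (x := x) (y := 2 * k + 3) (by linarith) (by positivity)
  have h₅ : Real.log (2 * k + 3) ≤ Real.log (x + 2) :=
    Real.log_le_log (by positivity) (by linarith)
  have h₆ : 0 ≤ Real.log (2 * k + 3) := Real.log_nonneg (by linarith)
  rw [heq]
  constructor <;> nlinarith

theorem logComb_ge {N : ℕ} (hN : 12 ≤ N) :
    (N : ℝ) * (5 / 12 * Real.log 2 + Real.log 3 / 8) - 15 * Real.log N - 3 / 2 ≤ logComb N := by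
  have hN' : (12 : ℝ) ≤ N := by exact_mod_cast hN
  have hdiv (j : ℕ) (hj : 1 ≤ j) (hj' : j ≤ 12) : 1 ≤ (N : ℝ) / j := by
    rw [le_div_iff₀ (by positivity), one_mul]
    exact_mod_cast hj'.trans hN
  have hodd (j : ℕ) (hj : 1 ≤ j) (hj' : j ≤ 12) :
      N / 2 / j * (Real.log N - Real.log j - 1) - Real.log N ≤ logSum chi₀ (N / j) ∧
      (2 ≤ j → logSum chi₀ (N / j) ≤
        N / 2 / j * (Real.log N - Real.log j - 1) + Real.log N + 1 / 2) := by
    have hjpos : (0 : ℝ) < j := by exact_mod_cast hj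
    have h := logSum_chi₀_bounds (hdiv j hj hj')
    rw [Nat.floor_div_natCast, Nat.floor_natCast, halfEntropy,
      Real.log_div (by positivity) hjpos.ne', div_right_comm] at h
    have hlogj : 0 ≤ Real.log j := Real.log_nonneg (by exact_mod_cast hj)
    refine ⟨by linarith, fun h2 ↦ ?_⟩
    have : Real.log (N / j + 2) ≤ Real.log N := by
      refine Real.log_le_log (by positivity) ?_
      have : (N : ℝ) / j ≤ N / 2 := by
        gcongr
        exact_mod_cast h2
      linarith
    linarith
  have hchi (j : ℕ) (hj : 1 ≤ j) (hj' : j ≤ 12) :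
      -(2 * Real.log N) ≤ logSum chi (N / j) ∧ logSum chi (N / j) ≤ Real.log N := by
    have hpos : 1 ≤ N / j := (Nat.le_div_iff_mul_le hj).2 (by omega)
    have h := logSum_chi_bounds hpos
    have : Real.log (N / j : ℕ) ≤ Real.log N :=
      Real.log_le_log (by exact_mod_cast hpos) (by exact_mod_cast Nat.div_le_self N j)
    constructor <;> linarith
  have a₁ := (hodd 1 (by norm_num) (by norm_num)).1
  have a₂ := (hodd 2 (by norm_num) (by norm_num)).2 (by norm_num)
  have a₃ := (hodd 3 (by norm_num) (by norm_num)).2 (by norm_num)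
  have a₄ := (hodd 4 (by norm_num) (by norm_num)).2 (by norm_num)
  have a₁₂ := (hodd 12 (by norm_num) (by norm_num)).1
  have b₁ := (hchi 1 (by norm_num) (by norm_num)).2
  have b₂ := (hchi 2 (by norm_num) (by norm_num)).1
  have b₃ := (hchi 3 (by norm_num) (by norm_num)).2
  have b₄ := (hchi 4 (by norm_num) (by norm_num)).2
  have b₆ := (hchi 6 (by norm_num) (by norm_num)).1
  have b₁₂ := (hchi 12 (by norm_num) (by norm_num)).2
  have l₁₂ : Real.log 12 = 2 * Real.log 2 + Real.log 3 := by
    rw [← Real.log_four_eq, ← Real.log_mul (by norm_num) (by norm_num)]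
    norm_num
  push_cast at a₁ a₂ a₃ a₄ a₁₂
  rw [Nat.div_one] at a₁ b₁
  rw [Real.log_one] at a₁
  rw [Real.log_four_eq] at a₄
  rw [l₁₂] at a₁₂
  unfold logComb
  linarith

theorem psi_le_log_four_mul_add {x y : ℝ} (hx : 1 ≤ x) (hxy : x ≤ y) :
    ψ x ≤ Real.log 4 * x + 2 * √y * Real.log y := by
  have h₁ := theta_le_log4_mul_x (zero_le_one.trans hx)
  have h₂ := psi_sub_theta_le hx
  have h₃ : 2 * √x * Real.log x ≤ 2 * √y * Real.log y := by
    have := Real.log_nonneg hx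
    gcongr
  linarith

theorem log_le_mul_sqrt {x : ℝ} (hx : 10 ^ 8 ≤ x) : Real.log x ≤ √x / 500 := by
  have hs : (10 ^ 4 : ℝ) ≤ √x := Real.le_sqrt_of_sq_le (by linarith)
  have h₁ : Real.log x = 2 * Real.log √x := by
    rw [Real.log_sqrt (by linarith)]
    ring
  have h₂ := Real.log_le_sub_one_of_pos (x := √x / 10 ^ 4) (by positivity)
  rw [Real.log_div (by positivity) (by positivity)] at h₂
  have h₃ : Real.log (10 ^ 4) ≤ Real.log (2 ^ 14) := Real.log_le_log (by norm_num) (by norm_num)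
  simp only [Real.log_pow] at h₂ h₃
  have := Real.log_two_lt_d9
  push_cast at h₃
  linarith

theorem exists_prime_of_large {n : ℕ} (hn : 50000000 ≤ n) :
    ∃ p : ℕ, p.Prime ∧ n ≤ p ∧ p < 2 * n ∧ (p % 8 = 3 ∨ p % 8 = 5) := by
  by_contra! hcon
  have hup := logComb_le (N := 2 * n) fun p hp hlt hle hmod ↦ by
    have := hcon p hp (by omega) (by omega)
    omega
  have hlow := logComb_ge (N := 2 * n) (by omega)
  set x : ℝ := ((2 * n : ℕ) : ℝ) with hx
  have hx8 : (10 ^ 8 : ℝ) ≤ x := by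
    rw [hx]
    exact_mod_cast (by omega : 10 ^ 8 ≤ 2 * n)
  have hs : (10 ^ 4 : ℝ) ≤ √x := Real.le_sqrt_of_sq_le (by linarith)
  have hsq : √x * √x = x := Real.mul_self_sqrt (by linarith)
  have hlog := log_le_mul_sqrt hx8
  have h₁ := psi_sub_theta_le (x := x) (by linarith)
  have h₁₃ := psi_le_log_four_mul_add (x := x / 13) (y := x) (by linarith) (by linarith)
  have h₃₁ := psi_le_log_four_mul_add (x := x / 31) (y := x) (by linarith) (by linarith)
  rw [Real.log_four_eq] at h₁₃ h₃₁
  have hsl : √x * Real.log x ≤ x / 500 := by nlinarith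
  have l2 := mul_le_mul_of_nonneg_left Real.log_two_gt_d9.le (by linarith : 0 ≤ x)
  have l2' := mul_le_mul_of_nonneg_left Real.log_two_lt_d9.le (by linarith : 0 ≤ x)
  have l3 := mul_le_mul_of_nonneg_left Real.log_three_gt_d9.le (by linarith : 0 ≤ x)
  nlinarith

/-- Every `[n, 2n)` with `2 ≤ n ≤ b` contains a prime congruent to `3` or `5` modulo `8`. -/
def BertrandUpTo (b : ℕ) : Prop :=
  ∀ n, 2 ≤ n → n ≤ b → ∃ p : ℕ, p.Prime ∧ n ≤ p ∧ p < 2 * n ∧ (p % 8 = 3 ∨ p % 8 = 5)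

theorem BertrandUpTo.extend {b : ℕ} (h : BertrandUpTo b) (q : ℕ) (hq : q.Prime)
    (hmod : q % 8 = 3 ∨ q % 8 = 5) (hle : q ≤ 2 * b + 1) : BertrandUpTo q := by
  intro n hn hnq
  rcases le_or_gt n b with hnb | hnb
  · exact h n hn hnb
  · exact ⟨q, hq, hnq, by omega, hmod⟩

theorem bertrandUpTo_64404581 : BertrandUpTo 64404581 := by
  have h : BertrandUpTo 3 := fun n hn hn' ↦ ⟨3, by norm_num, hn', by omega, by norm_num⟩
  replace h := h.extend 5 (by norm_num) (by norm_num) (by norm_num)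
  replace h := h.extend 11 (by norm_num) (by norm_num) (by norm_num)
  replace h := h.extend 19 (by norm_num) (by norm_num) (by norm_num)
  replace h := h.extend 37 (by norm_num) (by norm_num) (by norm_num)
  replace h := h.extend 67 (by norm_num) (by norm_num) (by norm_num)
  replace h := h.extend 131 (by norm_num) (by norm_num) (by norm_num)
  replace h := h.extend 251 (by norm_num) (by norm_num) (by norm_num)
  replace h := h.extend 499 (by norm_num) (by norm_num) (by norm_num)
  replace h := h.extend 997 (by norm_num) (by norm_num) (by norm_num)
  replace h := h.extend 1987 (by norm_num) (by norm_num) (by norm_num)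
  replace h := h.extend 3947 (by norm_num) (by norm_num) (by norm_num)
  replace h := h.extend 7883 (by norm_num) (by norm_num) (by norm_num)
  replace h := h.extend 15749 (by norm_num) (by norm_num) (by norm_num)
  replace h := h.extend 31477 (by norm_num) (by norm_num) (by norm_num)
  replace h := h.extend 62939 (by norm_num) (by norm_num) (by norm_num)
  replace h := h.extend 125821 (by norm_num) (by norm_num) (by norm_num)
  replace h := h.extend 251621 (by norm_num) (by norm_num) (by norm_num)
  replace h := h.extend 503227 (by norm_num) (by norm_num) (by norm_num)
  replace h := h.extend 1006339 (by norm_num) (by norm_num) (by norm_num)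
  replace h := h.extend 2012677 (by norm_num) (by norm_num) (by norm_num)
  replace h := h.extend 4025347 (by norm_num) (by norm_num) (by norm_num)
  replace h := h.extend 8050579 (by norm_num) (by norm_num) (by norm_num)
  replace h := h.extend 16101157 (by norm_num) (by norm_num) (by norm_num)
  replace h := h.extend 32202293 (by norm_num) (by norm_num) (by norm_num)
  replace h := h.extend 64404581 (by norm_num) (by norm_num) (by norm_num)
  exact h

theorem bertrand_three_or_five_mod_eight (n : ℕ) (hn : 2 ≤ n) :
    ∃ p : ℕ, p.Prime ∧ n ≤ p ∧ p < 2 * n ∧ (p % 8 = 3 ∨ p % 8 = 5) := by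
  rcases le_or_gt n 64404581 with h | h
  · exact bertrandUpTo_64404581 n hn h
  · exact exists_prime_of_large (by omega)
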